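/- Let Q : (0,1)^N → ℝ^N be a Borel triangular map satisfying the monotonicity condition (inc) and the consistency condition (con), and set μ := Q_# λ^N. Then the coupling π := (id, Q)_# λ^N is a bicausal coupling of λ^N and μ. -/

import Mathlib

open MeasureTheory ProbabilityTheory Filter Set
open scoped ENNReal NNReal Topology

/-- Lebesgue measure on `(0,1)`. -/
noncomputable def lambda01 : Measure ℝ := volume.restrict (Set.Ioo (0:ℝ) 1)

/-- The `N`-fold product of Lebesgue measure on `(0,1)`. -/
noncomputable def lambdaN (N : ℕ) : Measure (Fin N → ℝ) :=
  Measure.pi fun _ => lambda01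

/-- The open unit cube `(0,1)^N`. -/
def cube (N : ℕ) : Set (Fin N → ℝ) := {u | ∀ i, u i ∈ Set.Ioo (0:ℝ) 1}

/-- A map is triangular (adapted) if its `k`-th component depends only on the first `k`
coordinates. -/
def Triangular {N : ℕ} (Q : (Fin N → ℝ) → Fin N → ℝ) : Prop :=
  ∀ (k : Fin N) (u v : Fin N → ℝ), (∀ j ≤ k, u j = v j) → Q u k = Q v k

/-- Monotonicity condition (inc) on a set `s`: the `k`-th component is increasing in the
`k`-th coordinate (the earlier coordinates being fixed). -/
def IncOn {N : ℕ} (Q : (Fin N → ℝ) → Fin N → ℝ) (s : Set (Fin N → ℝ)) : Prop :=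
  ∀ k : Fin N, ∀ u ∈ s, ∀ v ∈ s, (∀ j < k, u j = v j) → u k ≤ v k → Q u k ≤ Q v k

/-- Strict monotonicity condition (sinc) on a set `s`. -/
def StrictIncOn {N : ℕ} (Q : (Fin N → ℝ) → Fin N → ℝ) (s : Set (Fin N → ℝ)) : Prop :=
  ∀ k : Fin N, ∀ u ∈ s, ∀ v ∈ s, (∀ j < k, u j = v j) → u k < v k → Q u k < Q v k

/-- Consistency condition (con) on a set `s`: if changing only the `k`-th coordinate does not
change the `k`-th component, then it does not change any later component `m ≥ k`. -/
def ConOn {N : ℕ} (Q : (Fin N → ℝ) → Fin N → ℝ) (s : Set (Fin N → ℝ)) : Prop :=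
  ∀ k m : Fin N, k ≤ m → ∀ u ∈ s, ∀ v ∈ s, (∀ j ≠ k, u j = v j) →
    Q u k = Q v k → Q u m = Q v m

/-- A quantile process: a Borel triangular map satisfying (inc) and (con) on the unit cube. -/
structure IsQuantileProcess {N : ℕ} (Q : (Fin N → ℝ) → Fin N → ℝ) : Prop where
  measurable : Measurable Q
  triangular : Triangular Q
  inc : IncOn Q (cube N)
  con : ConOn Q (cube N)

/-- The (a.e. unique) quantile process of `μ`, chosen via Hilbert's epsilon operator. -/
noncomputable def quantileProcess {N : ℕ} (μ : Measure (Fin N → ℝ)) :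
    (Fin N → ℝ) → Fin N → ℝ :=
  Classical.epsilon fun Q => IsQuantileProcess Q ∧ (lambdaN N).map Q = μ

/-- The cost `|x - y|_p^p = ∑ₖ |xₖ - yₖ|^p`, valued in `ℝ≥0∞`. -/
noncomputable def pCost (p : ℝ) {N : ℕ} (x y : Fin N → ℝ) : ℝ≥0∞ :=
  ∑ k, ENNReal.ofReal (|x k - y k| ^ p)

/-- The bounded cost `|x - y| ∧ 1` used for `p = 0`. -/
noncomputable def cost0 {N : ℕ} (x y : Fin N → ℝ) : ℝ≥0∞ :=
  ENNReal.ofReal (min ‖x - y‖ 1)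

/-- The `L_p(λ^N; ℝ^N)`-distance of two maps `(0,1)^N → ℝ^N`
(for `p = 0` the distance `∫ |f - g| ∧ 1 dλ^N` of convergence in probability). -/
noncomputable def Ldist (p : ℝ) {N : ℕ} (f g : (Fin N → ℝ) → Fin N → ℝ) : ℝ≥0∞ :=
  if p = 0 then ∫⁻ u, cost0 (f u) (g u) ∂(lambdaN N)
  else (∫⁻ u, pCost p (f u) (g u) ∂(lambdaN N)) ^ p⁻¹

/-- `μ ∈ P_p(ℝ^N)`: a Borel probability measure with finite `p`-th moments
(no moment condition when `p = 0`). -/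
def MemPp (p : ℝ) {N : ℕ} (μ : Measure (Fin N → ℝ)) : Prop :=
  IsProbabilityMeasure μ ∧
    (p = 0 ∨ ∫⁻ x, ∑ k, ENNReal.ofReal (|x k| ^ p) ∂μ < ⊤)

/-- `T` is `p`-integrable w.r.t. `λ^N` (no condition when `p = 0`). -/
def FinLp (p : ℝ) {N : ℕ} (T : (Fin N → ℝ) → Fin N → ℝ) : Prop :=
  p = 0 ∨ ∫⁻ u, ∑ k, ENNReal.ofReal (|T u k| ^ p) ∂(lambdaN N) < ⊤

/-- The Knothe–Rosenblatt distance `KR_p(μ,ν)` (for `p = 0` the metric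
`∫ |Q^μ - Q^ν| ∧ 1 dλ^N`). -/
noncomputable def KRdist (p : ℝ) {N : ℕ} (μ ν : Measure (Fin N → ℝ)) : ℝ≥0∞ :=
  Ldist p (quantileProcess μ) (quantileProcess ν)

/-- `π` is a coupling of `μ` and `ν`. -/
def IsCoupling {α β : Type*} [MeasurableSpace α] [MeasurableSpace β]
    (π : Measure (α × β)) (μ : Measure α) (ν : Measure β) : Prop :=
  π.map Prod.fst = μ ∧ π.map Prod.snd = ν

/-- `κ` is a disintegration (regular conditional law) of `ρ` w.r.t. its first coordinate. -/
def Disintegrates {α β : Type*} [MeasurableSpace α] [MeasurableSpace β]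
    (ρ : Measure (α × β)) (κ : Kernel α β) : Prop :=
  ∀ (A : Set α) (B : Set β), MeasurableSet A → MeasurableSet B →
    ρ (A ×ˢ B) = ∫⁻ a in A, κ a B ∂(ρ.map Prod.fst)

/-- The first `k` coordinates of `x : ℝ^N`. -/
def restr {N : ℕ} (k : Fin N) (x : Fin N → ℝ) : Fin (k : ℕ) → ℝ :=
  fun j => x ⟨j, j.isLt.trans k.isLt⟩

/-- A coupling `π` of `μ` and `ν` is bicausal if, for every `k`, the conditional law under `π`
of `(x_k, y_k)` given `(x_{1:k-1}, y_{1:k-1})` is a.s. a coupling of the conditional law of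
`x_k` given `x_{1:k-1}` under `μ` and that of `y_k` given `y_{1:k-1}` under `ν`. -/
def IsBicausal {N : ℕ} (μ ν : Measure (Fin N → ℝ))
    (π : Measure ((Fin N → ℝ) × (Fin N → ℝ))) : Prop :=
  IsCoupling π μ ν ∧
  ∀ k : Fin N,
    ∃ (κ : Kernel ((Fin (k : ℕ) → ℝ) × (Fin (k : ℕ) → ℝ)) (ℝ × ℝ))
      (κμ κν : Kernel (Fin (k : ℕ) → ℝ) ℝ),
      IsMarkovKernel κ ∧ IsMarkovKernel κμ ∧ IsMarkovKernel κν ∧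
      Disintegrates (μ.map fun x => (restr k x, x k)) κμ ∧
      Disintegrates (ν.map fun y => (restr k y, y k)) κν ∧
      Disintegrates (π.map fun xy => ((restr k xy.1, restr k xy.2), (xy.1 k, xy.2 k))) κ ∧
      ∀ᵐ ab ∂(π.map fun xy => (restr k xy.1, restr k xy.2)),
        IsCoupling (κ ab) (κμ ab.1) (κν ab.2)

/-- The adapted Wasserstein distance `AW_p` (for `p = 0` with cost `|x - y| ∧ 1`). -/
noncomputable def AWdist (p : ℝ) {N : ℕ} (μ ν : Measure (Fin N → ℝ)) : ℝ≥0∞ :=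
  ⨅ (π : Measure ((Fin N → ℝ) × (Fin N → ℝ))) (_ : IsBicausal μ ν π),
    if p = 0 then ∫⁻ xy, cost0 xy.1 xy.2 ∂π
    else (∫⁻ xy, pCost p xy.1 xy.2 ∂π) ^ p⁻¹

/-- A measurable map out of a standard Borel space that factors set-theoretically through a
measurable map also factors through it measurably. -/
theorem Measurable.exists_measurable_of_factorsThrough {X Y Z : Type*} [MeasurableSpace X]
    [StandardBorelSpace X] [MeasurableSpace Y] [StandardBorelSpace Y] [MeasurableSpace Z]
    [StandardBorelSpace Z] [Nonempty Z] {f : X → Y} {g : X → Z} (hf : Measurable f)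
    (hg : Measurable g) (hfg : g.FactorsThrough f) :
    ∃ h : Y → Z, Measurable h ∧ g = h ∘ f := by
  obtain ⟨h₀, rfl⟩ := (Function.factorsThrough_iff g).1 hfg
  refine Measurable.exists_eq_measurable_comp fun s hs => ?_
  obtain ⟨t, ht, hts⟩ := (hf.measurableSet_preimage_iff_preimage_val (s := h₀ ⁻¹' s)).1 (hg hs)
  refine ⟨t, ht, Set.ext fun x => ?_⟩
  exact Set.ext_iff.1 hts ⟨f x, x, rfl⟩

/-- The kernel sending `a` to the law of `H (a, ·)` under `ν`. -/
noncomputable def fibreLaw {α τ γ : Type*} [MeasurableSpace α] [MeasurableSpace τ]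
    [MeasurableSpace γ] (ν : Measure τ) (H : α × τ → γ) : Kernel α γ :=
  (Kernel.id ×ₖ Kernel.const α ν).map H

section fibreLaw

variable {Ω α τ γ : Type*} [MeasurableSpace Ω] [MeasurableSpace α] [MeasurableSpace τ]
  [MeasurableSpace γ]

theorem isMarkovKernel_fibreLaw {ν : Measure τ} [IsProbabilityMeasure ν] {H : α × τ → γ}
    (hH : Measurable H) : IsMarkovKernel (fibreLaw ν H) :=
  Kernel.IsMarkovKernel.map _ hH

theorem fibreLaw_eq_map {ν : Measure τ} [IsProbabilityMeasure ν] {H : α × τ → γ}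
    (hH : Measurable H) (a : α) : fibreLaw ν H a = ν.map fun t => H (a, t) := by
  rw [fibreLaw, Kernel.map_apply _ hH, Kernel.prod_apply, Kernel.id_apply, Kernel.const_apply,
    Measure.dirac_prod, Measure.map_map hH measurable_prodMk_left]
  rfl

/-- If `S` and `T` are independent, then the conditional law of `H (S, T)` given `S = a` is the
law of `H (a, T)`. -/
theorem disintegrates_fibreLaw {P : Measure Ω} [IsProbabilityMeasure P] {S : Ω → α} {T : Ω → τ}
    (hS : Measurable S) (hT : Measurable T) (hST : IndepFun S T P) {H : α × τ → γ}
    (hH : Measurable H) :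
    Disintegrates (P.map fun ω => (S ω, H (S ω, T ω))) (fibreLaw (P.map T) H) := by
  intro A B hA hB
  have := Measure.isProbabilityMeasure_map (μ := P) hS.aemeasurable
  have := Measure.isProbabilityMeasure_map (μ := P) hT.aemeasurable
  have hK : Measurable fun p : α × τ => (p.1, H p) := measurable_fst.prodMk hH
  have hmap : (P.map fun ω => (S ω, H (S ω, T ω))) =
      ((P.map S).prod (P.map T)).map fun p => (p.1, H p) := by
    rw [← (indepFun_iff_map_prod_eq_prod_map_map hS.aemeasurable hT.aemeasurable).1 hST,
      Measure.map_map hK (hS.prodMk hT)]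
    rfl
  have hfst : (((P.map S).prod (P.map T)).map fun p => (p.1, H p)).map Prod.fst = P.map S := by
    rw [Measure.map_map measurable_fst hK]
    exact measurePreserving_fst.map_eq
  rw [hmap, hfst, Measure.map_apply hK (hA.prod hB), Measure.prod_apply (hK (hA.prod hB)),
    ← lintegral_indicator hA]
  refine lintegral_congr fun a => ?_
  by_cases ha : a ∈ A
  · rw [Set.indicator_of_mem ha, fibreLaw_eq_map hH, Measure.map_apply (by fun_prop) hB]
    congr 1
    ext t
    simp [ha]
  · rw [Set.indicator_of_notMem ha]
    convert measure_empty (μ := P.map T)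
    ext t
    simp [ha]

end fibreLaw

instance isProbabilityMeasure_lambda01 : IsProbabilityMeasure lambda01 :=
  ⟨by simp [lambda01]⟩

instance isProbabilityMeasure_lambdaN (N : ℕ) : IsProbabilityMeasure (lambdaN N) := by
  unfold lambdaN
  infer_instance

theorem measurableSet_cube (N : ℕ) : MeasurableSet (cube N) := by
  have : cube N = Set.univ.pi fun _ => Set.Ioo (0 : ℝ) 1 := by
    ext
    simp [cube]
  rw [this]
  exact MeasurableSet.univ_pi fun _ => measurableSet_Ioo

theorem ae_mem_cube (N : ℕ) : ∀ᵐ u ∂lambdaN N, u ∈ cube N := by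
  refine ae_all_iff.2 fun i => ?_
  exact (measurePreserving_eval (fun _ : Fin N => lambda01) i).quasiMeasurePreserving.ae
    (ae_restrict_mem measurableSet_Ioo)

theorem lambdaN_map_eval {N : ℕ} (k : Fin N) : (lambdaN N).map (fun u => u k) = lambda01 :=
  (measurePreserving_eval (fun _ : Fin N => lambda01) k).map_eq

theorem measurable_restr {N : ℕ} (k : Fin N) : Measurable (restr k) :=
  measurable_pi_lambda _ fun _ => measurable_pi_apply _

theorem indepFun_restr_eval {N : ℕ} (k : Fin N) :
    IndepFun (restr k) (fun u => u k) (lambdaN N) := by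
  have hind : iIndepFun (fun (i : Fin N) (u : Fin N → ℝ) => u i) (lambdaN N) :=
    iIndepFun_pi (X := fun _ => id) fun _ => aemeasurable_id
  have h := hind.indepFun_finset (Finset.Iio k) {k} (by simp) fun i => measurable_pi_apply i
  have h₁ : Measurable fun (w : Finset.Iio k → ℝ) (j : Fin (k : ℕ)) =>
      w ⟨⟨j, j.isLt.trans k.isLt⟩, Finset.mem_Iio.2 j.isLt⟩ :=
    measurable_pi_lambda _ fun _ => measurable_pi_apply _
  have h₂ : Measurable fun w : ({k} : Finset (Fin N)) → ℝ => w ⟨k, Finset.mem_singleton_self k⟩ :=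
    measurable_pi_apply _
  exact h.comp h₁ h₂

/-- On the cube, replacing the first coordinates of `u` by those of `v` does not change the later
components of `Q`, provided that `Q u` and `Q v` agree in the corresponding components. -/
theorem IsQuantileProcess.apply_splice_eq {N : ℕ} {Q : (Fin N → ℝ) → Fin N → ℝ}
    (hQ : IsQuantileProcess Q) {u v : Fin N → ℝ} (hu : u ∈ cube N) (hv : v ∈ cube N) (i : ℕ)
    (huv : ∀ j : Fin N, (j : ℕ) < i → Q u j = Q v j) (m : Fin N) (him : i ≤ m) :
    Q (fun j => if (j : ℕ) < i then v j else u j) m = Q u m := by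
  have hmem (i : ℕ) : (fun j : Fin N => if (j : ℕ) < i then v j else u j) ∈ cube N := by
    intro j
    dsimp only
    split_ifs
    exacts [hv j, hu j]
  induction i generalizing m with
  | zero => simp
  | succ i ih =>
    have ih := ih fun j hj => huv j (by omega)
    have hiN : i < N := by omega
    rw [← ih m (by omega)]
    refine (hQ.con ⟨i, hiN⟩ m (Fin.mk_le_of_le_val (by omega)) _ (hmem i) _ (hmem (i + 1))
      (fun j hj => ?_) ?_).symm
    · have : (j : ℕ) ≠ i := fun h => hj (Fin.ext h)
      simp only [show (j : ℕ) < i + 1 ↔ (j : ℕ) < i by omega]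
    · rw [ih ⟨i, hiN⟩ le_rfl, huv ⟨i, hiN⟩ (Nat.lt_succ_self i)]
      refine hQ.triangular _ _ _ fun j hj => ?_
      have : (j : ℕ) ≤ i := hj
      simp [show (j : ℕ) < i + 1 by omega]

/-- On the cube, the `k`-th component of a quantile process is a measurable function of the previous
components and of the `k`-th coordinate. -/
theorem IsQuantileProcess.exists_measurable_update {N : ℕ} {Q : (Fin N → ℝ) → Fin N → ℝ}
    (hQ : IsQuantileProcess Q) (k : Fin N) :
    ∃ h : (Fin (k : ℕ) → ℝ) × ℝ → ℝ, Measurable h ∧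
      ∀ u ∈ cube N, Q u k = h (restr k (Q u), u k) := by
  have : StandardBorelSpace (cube N) := (measurableSet_cube N).standardBorel
  have hQm : Measurable fun u : cube N => Q u := hQ.measurable.comp measurable_subtype_coe
  obtain ⟨h, hh, heq⟩ := Measurable.exists_measurable_of_factorsThrough
    (f := fun u : cube N => (restr k (Q u), u.1 k)) (g := fun u : cube N => Q u k)
    (((measurable_restr k).comp hQm).prodMk
      ((measurable_pi_apply k).comp measurable_subtype_coe))
    ((measurable_pi_apply k).comp hQm) (by
      rintro ⟨u, hu⟩ ⟨v, hv⟩ huv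
      obtain ⟨hr, hk⟩ := Prod.mk.inj huv
      dsimp only at hr hk ⊢
      rw [← hQ.apply_splice_eq hu hv k (fun j hj => congrFun hr ⟨j, hj⟩) k le_rfl]
      refine hQ.triangular _ _ _ fun j hj => ?_
      rcases hj.lt_or_eq with hj | rfl
      · simp [Fin.lt_def.1 hj]
      · simpa using hk)
  exact ⟨h, hh, fun u hu => congrFun heq ⟨u, hu⟩⟩

theorem IsQuantileProcess.exists_measurable_restr {N : ℕ} {Q : (Fin N → ℝ) → Fin N → ℝ}
    (hQ : IsQuantileProcess Q) (k : Fin N) :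
    ∃ R : (Fin (k : ℕ) → ℝ) → Fin (k : ℕ) → ℝ, Measurable R ∧
      ∀ u, restr k (Q u) = R (restr k u) := by
  have he : Measurable fun (a : Fin (k : ℕ) → ℝ) (j : Fin N) =>
      if hj : (j : ℕ) < k then a ⟨j, hj⟩ else 0 := by
    refine measurable_pi_lambda _ fun j => ?_
    split_ifs
    exacts [measurable_pi_apply _, measurable_const]
  refine ⟨_, (measurable_restr k).comp (hQ.measurable.comp he), fun u => ?_⟩
  ext i
  refine hQ.triangular _ _ _ fun j hj => ?_
  have : (j : ℕ) < k := lt_of_le_of_lt (Fin.le_def.1 hj) i.isLt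
  simp [restr, this]

/-- If `Q` is a quantile process and `μ := Q_# λ^N`, then
`π := (id, Q)_# λ^N` is a bicausal coupling of `λ^N` and `μ`. -/
theorem quantileProcess_graph_bicausal (N : ℕ) (Q : (Fin N → ℝ) → Fin N → ℝ)
    (hQ : IsQuantileProcess Q) :
    IsBicausal (lambdaN N) ((lambdaN N).map Q) ((lambdaN N).map fun u => (u, Q u)) := by
  have hQm := hQ.measurable
  have hG : Measurable fun u => (u, Q u) := measurable_id.prodMk hQm
  refine ⟨⟨?_, ?_⟩, fun k => ?_⟩
  · rw [Measure.map_map measurable_fst hG]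
    exact Measure.map_id
  · rw [Measure.map_map measurable_snd hG]
    rfl
  obtain ⟨h, hh, hQh⟩ := hQ.exists_measurable_update k
  obtain ⟨R, hR, hQR⟩ := hQ.exists_measurable_restr k
  have hr := measurable_restr k
  have hk : Measurable fun u : Fin N → ℝ => u k := measurable_pi_apply k
  have hrQ := hr.comp hQm
  have hae : ∀ᵐ u ∂lambdaN N, Q u k = h (restr k (Q u), u k) := (ae_mem_cube N).mono hQh
  have hind := indepFun_restr_eval k
  have hindQ : IndepFun (fun u => restr k (Q u)) (fun u => u k) (lambdaN N) := by
    simp_rw [hQR]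
    exact hind.comp hR measurable_id
  have hindG : IndepFun (fun u => (restr k u, restr k (Q u))) (fun u => u k) (lambdaN N) := by
    simp_rw [hQR]
    exact hind.comp (measurable_id.prodMk hR) measurable_id
  have hH : Measurable fun p : ((Fin (k : ℕ) → ℝ) × (Fin (k : ℕ) → ℝ)) × ℝ =>
      (p.2, h (p.1.2, p.2)) := by fun_prop
  refine ⟨fibreLaw lambda01 fun p => (p.2, h (p.1.2, p.2)), fibreLaw lambda01 Prod.snd,
    fibreLaw lambda01 h, isMarkovKernel_fibreLaw hH, isMarkovKernel_fibreLaw measurable_snd,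
    isMarkovKernel_fibreLaw hh, ?_, ?_, ?_, ae_of_all _ fun ab => ⟨?_, ?_⟩⟩
  · rw [← lambdaN_map_eval k]
    exact disintegrates_fibreLaw hr hk hind measurable_snd
  · have hmap : ((lambdaN N).map Q).map (fun y => (restr k y, y k)) =
        (lambdaN N).map fun u => (restr k (Q u), h (restr k (Q u), u k)) := by
      rw [Measure.map_map (hr.prodMk hk) hQm]
      exact Measure.map_congr (hae.mono fun u hu => Prod.ext rfl hu)
    rw [hmap, ← lambdaN_map_eval k]
    exact disintegrates_fibreLaw hrQ hk hindQ hh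
  · have hmap : ((lambdaN N).map fun u => (u, Q u)).map
          (fun xy => ((restr k xy.1, restr k xy.2), (xy.1 k, xy.2 k))) =
        (lambdaN N).map fun u =>
          ((restr k u, restr k (Q u)), (u k, h (restr k (Q u), u k))) := by
      rw [Measure.map_map _ hG]
      · exact Measure.map_congr (hae.mono fun u hu => Prod.ext rfl (Prod.ext rfl hu))
      · fun_prop
    rw [hmap, ← lambdaN_map_eval k]
    exact disintegrates_fibreLaw (hr.prodMk hrQ) hk hindG hH
  · rw [fibreLaw_eq_map hH, fibreLaw_eq_map measurable_snd,
      Measure.map_map measurable_fst (by fun_prop)]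
    rfl
  · rw [fibreLaw_eq_map hH, fibreLaw_eq_map hh,
      Measure.map_map measurable_snd (by fun_prop)]
    rfl
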